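/- arXiv:2507.10937 — 2 statements merged into one kernel-verified Lean document; each statement's English description precedes it below -/
import Mathlib

section
/- Let K ⊊ L be a field extension, and let A and B be n-dimensional K-subspaces of L with n > 0 and 1 ∉ B. Suppose n < n₀(K, L), where n₀(K, L) denotes the smallest degree [F : K] over all intermediate fields K ⊊ F ⊆ L with [F : K] finite. Then A is matched to B. -/
/-- An ordered basis `a : Fin n → L` of the `K`-subspace `A` is matched to an ordered
basis `b : Fin n → L` of `B` if `(a i)⁻¹ A ∩ B ⊆ span (b j : j ≠ i)` for each `i`.
`A` is matched to `B` if every ordered basis of `A` can be matched to some ordered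
basis of `B`. -/
def IsMatchedTo {K L : Type*} [Field K] [Field L] [Algebra K L]
    (A B : Submodule K L) : Prop :=
  ∀ (n : ℕ) (a : Fin n → L), LinearIndependent K a → Submodule.span K (Set.range a) = A →
    ∃ b : Fin n → L, LinearIndependent K b ∧ Submodule.span K (Set.range b) = B ∧
      ∀ i : Fin n, ∀ x ∈ A, (a i)⁻¹ * x ∈ B →
        (a i)⁻¹ * x ∈ Submodule.span K (b '' {j | j ≠ i})

/-- A linear analogue of the Cauchy–Davenport theorem: if every nontrivial finite intermediate
field has degree larger than `dim C`, then `S * U ⊆ C` forces `dim S + dim U ≤ dim C + 1`. -/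
theorem Submodule.finrank_add_finrank_le_of_mul_le {K L : Type*} [Field K] [Field L] [Algebra K L]
    (C : Submodule K L) [FiniteDimensional K C]
    (hC : ∀ F : IntermediateField K L, F ≠ ⊥ → FiniteDimensional K F →
      Module.finrank K C < Module.finrank K F)
    (S U : Submodule K L) [FiniteDimensional K U] (hS : S ≠ ⊥) (hU : (1 : L) ∈ U)
    (hSU : S * U ≤ C) :
    Module.finrank K S + Module.finrank K U ≤ Module.finrank K C + 1 := by
  induction h : Module.finrank K U using Nat.strong_induction_on generalizing S U with
  | _ d ih =>
  subst h
  have hSC : S ≤ C := fun x hx => hSU (by simpa using Submodule.mul_mem_mul hx hU)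
  have : FiniteDimensional K S := Submodule.finiteDimensional_of_le hSC
  by_cases hstab : S * U ≤ S
  · let F : Subalgebra K L := Algebra.adjoin K (U : Set L)
    obtain ⟨s, hs, hs0⟩ := S.exists_mem_ne_zero_of_ne_bot hS
    have hF : ∀ x ∈ F, ∀ y ∈ S, x * y ∈ S := by
      intro x hx
      induction hx using Algebra.adjoin_induction with
      | mem x hx =>
        intro y hy
        rw [mul_comm]
        exact hstab (Submodule.mul_mem_mul hy hx)
      | algebraMap r =>
        intro y hy
        rw [← Algebra.smul_def]
        exact S.smul_mem r hy
      | add x z _ _ hx hz =>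
        intro y hy
        rw [add_mul]
        exact S.add_mem (hx y hy) (hz y hy)
      | mul x z _ _ hx hz =>
        intro y hy
        rw [mul_assoc]
        exact hx _ (hz y hy)
    let f : F →ₗ[K] S :=
      ((LinearMap.mulRight K s).comp F.val.toLinearMap).codRestrict S
        fun x => hF x x.2 s hs
    have hf : Function.Injective f := by
      intro x y hxy
      have hxy' : (x : L) * s = y * s := congrArg Subtype.val hxy
      exact Subtype.ext (mul_right_cancel₀ hs0 hxy')
    have hfin : FiniteDimensional K F := FiniteDimensional.of_injective f hf
    let F' : IntermediateField K L := F.toIntermediateField fun x hx =>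
      F.inv_mem_of_algebraic (x := ⟨x, hx⟩)
        ((Algebra.IsAlgebraic.isAlgebraic (R := K) (⟨x, hx⟩ : F)).algebraMap (A := L))
    have hF'S : Module.finrank K F' ≤ Module.finrank K S :=
      LinearMap.finrank_le_finrank_of_injective (f := f) hf
    have hbot : F' = ⊥ := by
      by_contra hne
      have h1 := hC F' hne hfin
      have h2 := Submodule.finrank_mono hSC
      omega
    have hU1 : U ≤ 1 := by
      intro x hx
      have hx' : x ∈ F' := Algebra.subset_adjoin hx
      rw [hbot, IntermediateField.mem_bot] at hx'
      exact Submodule.mem_one.2 hx'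
    have h2 : Module.finrank K (1 : Submodule K L) = 1 := by
      rw [Submodule.one_eq_span]
      exact finrank_span_singleton one_ne_zero
    have : FiniteDimensional K (1 : Submodule K L) := Module.finite_of_finrank_pos (by omega)
    have h1 := Submodule.finrank_mono hU1
    have h3 := Submodule.finrank_mono hSC
    omega
  · rw [Submodule.mul_le] at hstab
    push Not at hstab
    obtain ⟨e, he, u, hu, heu⟩ := hstab
    have he0 : e ≠ 0 := by
      rintro rfl
      simp at heu
    let m : L ≃ₗ[K] L := LinearEquiv.ofBijective (LinearMap.mulLeft K e)
      ⟨mul_right_injective₀ he0, mul_left_surjective₀ he0⟩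
    have hm : ∀ x, m x = e * x := fun x => rfl
    let S' : Submodule K L := S ⊔ U.map m.toLinearMap
    let U' : Submodule K L := U ⊓ S.comap m.toLinearMap
    have hU'U : U' < U := lt_of_le_of_ne inf_le_left fun heq => by
      have hu' : u ∈ U' := heq ▸ hu
      exact heu hu'.2
    have : FiniteDimensional K U' := Submodule.finiteDimensional_of_le hU'U.le
    have hS' : S' ≠ ⊥ := fun hb => hS (le_bot_iff.1 (hb ▸ le_sup_left))
    have hU' : (1 : L) ∈ U' := ⟨hU, by simpa [hm] using he⟩
    have hmul : S' * U' ≤ C := by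
      rw [Submodule.sup_mul, sup_le_iff]
      refine ⟨(mul_le_mul_right inf_le_left _).trans hSU, Submodule.mul_le.2 ?_⟩
      rintro _ ⟨x, hx, rfl⟩ y ⟨-, hy⟩
      have : m x * y = m y * x := by simp only [hm]; ring
      change m x * y ∈ C
      rw [this]
      exact hSU (Submodule.mul_mem_mul hy hx)
    have hih := ih _ (Submodule.finrank_lt_finrank_of_lt hU'U) S' U' hS' hU' hmul rfl
    have hdim := Submodule.finrank_sup_add_finrank_inf_eq S (U.map m.toLinearMap)
    have hinf : Module.finrank K (S ⊓ U.map m.toLinearMap : Submodule K L)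
        = Module.finrank K U' := by
      have : S ⊓ U.map m.toLinearMap = U'.map m.toLinearMap := by
        ext x
        constructor
        · rintro ⟨hx, y, hy, rfl⟩
          exact ⟨y, ⟨hy, hx⟩, rfl⟩
        · rintro ⟨y, ⟨hy, hy'⟩, rfl⟩
          exact ⟨hy', y, hy, rfl⟩
      rw [this]
      exact LinearEquiv.finrank_map_eq m U'
    have hUm : Module.finrank K (U.map m.toLinearMap) = Module.finrank K U :=
      LinearEquiv.finrank_map_eq m U
    change Module.finrank K S' + _ = _ at hdim
    omega

/-- Rado's theorem for subspaces: a finite family of subspaces satisfying the dimension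
version of Hall's condition has a linearly independent system of representatives. -/
theorem exists_linearIndependent_mem_of_card_le_finrank {K V ι : Type*} [Field K]
    [AddCommGroup V] [Module K V] [FiniteDimensional K V] [Fintype ι]
    (W : ι → Submodule K V)
    (hW : ∀ J : Finset ι, J.card ≤ Module.finrank K (J.sup W : Submodule K V)) :
    ∃ v : ι → V, (∀ i, v i ∈ W i) ∧ LinearIndependent K v := by
  classical
  induction h : ∑ i, Module.finrank K (W i) using Nat.strong_induction_on generalizing W with
  | _ d ih =>
  subst h
  by_cases hsplit : ∃ i, ∃ X Y : Submodule K V, X < W i ∧ Y < W i ∧ X ⊔ Y = W i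
  · obtain ⟨i, X, Y, hX, hY, hXY⟩ := hsplit
    have step : ∀ Z : Submodule K V, Z < W i →
        (∃ v : ι → V, (∀ i, v i ∈ W i) ∧ LinearIndependent K v) ∨
        ∃ J : Finset ι, i ∉ J ∧ Module.finrank K (Z ⊔ J.sup W : Submodule K V) ≤ J.card := by
      intro Z hZ
      by_cases hgood : ∀ J : Finset ι,
          J.card ≤ Module.finrank K (J.sup (Function.update W i Z) : Submodule K V)
      · left
        have hlt : ∑ j, Module.finrank K (Function.update W i Z j)
            < ∑ j, Module.finrank K (W j) := by
          refine Finset.sum_lt_sum (fun j _ => ?_) ⟨i, Finset.mem_univ i, ?_⟩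
          · rcases eq_or_ne j i with rfl | hj
            · rw [Function.update_self]
              exact Submodule.finrank_mono hZ.le
            · rw [Function.update_of_ne hj]
          · rw [Function.update_self]
            exact Submodule.finrank_lt_finrank_of_lt hZ
        obtain ⟨v, hv, hli⟩ := ih _ hlt _ hgood rfl
        refine ⟨v, fun j => ?_, hli⟩
        have := hv j
        rcases eq_or_ne j i with rfl | hj
        · exact hZ.le (by simpa using this)
        · simpa [hj] using this
      · right
        push Not at hgood
        obtain ⟨J, hJ⟩ := hgood
        have hcongr : ∀ I : Finset ι, i ∉ I → I.sup (Function.update W i Z) = I.sup W :=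
          fun I hI => Finset.sup_congr rfl fun j hj =>
            Function.update_of_ne (ne_of_mem_of_not_mem hj hI) _ _
        have hiJ : i ∈ J := by
          by_contra hi
          rw [hcongr J hi] at hJ
          exact (hW J).not_gt hJ
        refine ⟨J.erase i, Finset.notMem_erase i J, ?_⟩
        rw [← Finset.insert_erase hiJ, Finset.sup_insert, hcongr _ (Finset.notMem_erase i J),
          Function.update_self, Finset.card_insert_of_notMem (Finset.notMem_erase i J)] at hJ
        exact Nat.lt_succ_iff.1 hJ
    rcases step X hX with hv | ⟨I, hI, hIX⟩
    · exact hv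
    rcases step Y hY with hv | ⟨J, hJ, hJY⟩
    · exact hv
    exfalso
    have hdim := Submodule.finrank_sup_add_finrank_inf_eq (X ⊔ I.sup W) (Y ⊔ J.sup W)
    have hsup : (X ⊔ I.sup W) ⊔ (Y ⊔ J.sup W) = (insert i (I ∪ J)).sup W := by
      rw [Finset.sup_insert, Finset.sup_union, ← hXY, sup_sup_sup_comm]
    have hinf : (I ∩ J).sup W ≤ (X ⊔ I.sup W) ⊓ (Y ⊔ J.sup W) :=
      le_inf ((Finset.sup_mono Finset.inter_subset_left).trans le_sup_right)
        ((Finset.sup_mono Finset.inter_subset_right).trans le_sup_right)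
    have h1 := hW (insert i (I ∪ J))
    have h2 := (hW (I ∩ J)).trans (Submodule.finrank_mono hinf)
    rw [Finset.card_insert_of_notMem (by simp [hI, hJ])] at h1
    rw [hsup] at hdim
    have h3 := Finset.card_union_add_card_inter I J
    omega
  · push Not at hsplit
    have hspan : ∀ i, ∃ v, W i = Submodule.span K {v} := by
      intro i
      have hne : W i ≠ ⊥ := by
        intro hbot
        have := hW {i}
        simp [hbot] at this
      obtain ⟨v, hv, hv0⟩ := (W i).exists_mem_ne_zero_of_ne_bot hne
      refine ⟨v, ?_⟩
      by_contra hvne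
      have hle : Submodule.span K {v} ≤ W i := by simpa using hv
      obtain ⟨Y, hY⟩ := Submodule.exists_isCompl (Submodule.span K {v})
      refine hsplit i (Submodule.span K {v}) (Y ⊓ W i) (lt_of_le_of_ne hle (Ne.symm hvne))
        (lt_of_le_of_ne inf_le_right fun heq => ?_) ?_
      · exact hv0 (Submodule.disjoint_def.1 hY.disjoint v (Submodule.mem_span_singleton_self v)
          (inf_eq_right.1 heq hv))
      · rw [← sup_inf_assoc_of_le Y hle, hY.sup_eq_top, top_inf_eq]
    choose v hv using hspan
    refine ⟨v, fun i => hv i ▸ Submodule.mem_span_singleton_self _, ?_⟩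
    rw [linearIndependent_iff_card_le_finrank_span]
    have huniv := hW Finset.univ
    have : Finset.univ.sup W = Submodule.span K (Set.range v) := by
      rw [Finset.sup_univ_eq_iSup, Submodule.span_range_eq_iSup]
      exact iSup_congr hv
    rw [this] at huniv
    exact huniv

/-- If the subspaces `V i` of `E` satisfy `dim (⋂ i ∈ J, V i) + |J| ≤ dim E` for every `J`,
then `E` has a basis whose `i`-th coordinate vanishes on `V i`. -/
theorem exists_basis_repr_eq_zero_of_finrank_inf_add_card_le {K E ι : Type*} [Field K]
    [AddCommGroup E] [Module K E] [FiniteDimensional K E] [Fintype ι]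
    (hcard : Fintype.card ι = Module.finrank K E) (V : ι → Submodule K E)
    (hV : ∀ J : Finset ι,
      Module.finrank K (J.inf V : Submodule K E) + J.card ≤ Module.finrank K E) :
    ∃ b : Module.Basis ι K E, ∀ i, ∀ x ∈ V i, b.repr x i = 0 := by
  classical
  obtain ⟨φ, hφ, hli⟩ := exists_linearIndependent_mem_of_card_le_finrank
    (fun i => (V i).dualAnnihilator) fun J => by
      have hsup : (J.sup fun i => (V i).dualAnnihilator) = (J.inf V).dualAnnihilator := by
        induction J using Finset.induction_on with
        | empty => simp
        | insert i J _ ih =>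
          rw [Finset.sup_insert, Finset.inf_insert, ih, Subspace.dualAnnihilator_inf_eq]
      rw [hsup]
      have h1 := Subspace.finrank_add_finrank_dualAnnihilator_eq (J.inf V)
      have h2 := hV J
      omega
  have hspan : Submodule.span K (Set.range φ) = ⊤ :=
    hli.span_eq_top_of_card_eq_finrank' (by rw [hcard, Subspace.dual_finrank_eq])
  have hinj : Function.Injective (LinearMap.pi φ) := by
    rw [injective_iff_map_eq_zero]
    intro x hx
    rw [← Module.forall_dual_apply_eq_zero_iff K]
    intro ψ
    have hψ : ψ ∈ Submodule.span K (Set.range φ) := hspan ▸ Submodule.mem_top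
    induction hψ using Submodule.span_induction with
    | mem ψ h =>
      obtain ⟨i, rfl⟩ := h
      exact congrFun hx i
    | zero => rfl
    | add ψ χ _ _ h h' => simp [h, h']
    | smul c ψ _ h => simp [h]
  let e : E ≃ₗ[K] (ι → K) := LinearEquiv.ofInjectiveOfFinrankEq (LinearMap.pi φ) hinj
    (by simp [hcard])
  refine ⟨Module.Basis.ofEquivFun e, fun i x hx => ?_⟩
  rw [Module.Basis.ofEquivFun_repr_apply]
  exact (Submodule.mem_dualAnnihilator _).1 (hφ i) x hx

/-- If `n` is smaller than the degree of every nontrivial finite-dimensional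
intermediate field of `K ⊊ L`, and `1 ∉ B`, then `A` is matched to `B`. -/
theorem stmt_14 {K L : Type*} [Field K] [Field L] [Algebra K L]
    (hKL : ∃ x : L, x ∉ Set.range (algebraMap K L))
    (A B : Submodule K L) (n : ℕ) (hn : 0 < n)
    (hA : Module.finrank K A = n) (hB : Module.finrank K B = n)
    (h1 : (1 : L) ∉ B)
    (hn0 : ∀ F : IntermediateField K L, F ≠ ⊥ → FiniteDimensional K F →
      n < Module.finrank K F) :
    IsMatchedTo A B := by
  classical
  intro m a hli hspan
  have hmn : m = n := by
    rw [← hA, ← hspan, finrank_span_eq_card hli, Fintype.card_fin]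
  subst hmn
  have : FiniteDimensional K A := Module.finite_of_finrank_pos (by omega)
  have : FiniteDimensional K B := Module.finite_of_finrank_pos (by omega)
  have haA : ∀ i, a i ∈ A := fun i => hspan ▸ Submodule.subset_span ⟨i, rfl⟩
  let V : Fin m → Submodule K B := fun i =>
    A.comap ((LinearMap.mulLeft K (a i)).comp B.subtype)
  have hV : ∀ J : Finset (Fin m),
      Module.finrank K (J.inf V : Submodule K B) + J.card ≤ Module.finrank K B := by
    intro J
    rcases J.eq_empty_or_nonempty with rfl | ⟨j, hj⟩
    · simpa using Submodule.finrank_le ((∅ : Finset (Fin m)).inf V)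
    let S : Submodule K L := Submodule.span K (a '' J)
    let T : Submodule K L := (J.inf V).map B.subtype
    have hSA : S ≤ A := by
      rw [Submodule.span_le]
      rintro _ ⟨i, -, rfl⟩
      exact haA i
    have hS : Module.finrank K S = J.card := by
      have hliJ : LinearIndependent K fun i : J => a i := hli.comp _ Subtype.val_injective
      have hrange : Set.range (fun i : J => a i) = a '' J := by
        ext x
        simp
      have := finrank_span_eq_card hliJ
      rw [hrange] at this
      simpa using this
    have hT : Module.finrank K T = Module.finrank K (J.inf V : Submodule K B) :=
      Submodule.finrank_map_subtype_eq B (J.inf V)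
    have hST : S * T ≤ A := by
      rw [← Submodule.span_eq T, Submodule.span_mul_span, Submodule.span_le]
      rintro _ ⟨_, ⟨i, hi, rfl⟩, _, ⟨y, hy, rfl⟩, rfl⟩
      exact (Finset.inf_le (f := V) (Finset.mem_coe.1 hi)) hy
    have hTB : T ≤ B := Submodule.map_subtype_le B _
    have : FiniteDimensional K T := Submodule.finiteDimensional_of_le hTB
    have hone : Module.finrank K (1 : Submodule K L) = 1 := by
      rw [Submodule.one_eq_span]
      exact finrank_span_singleton one_ne_zero
    have : FiniteDimensional K (1 : Submodule K L) := Module.finite_of_finrank_pos (by omega)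
    have hdisj : (1 : Submodule K L) ⊓ T = ⊥ := by
      rw [← disjoint_iff, Submodule.one_eq_span, disjoint_comm,
        Submodule.disjoint_span_singleton' one_ne_zero]
      exact fun h => h1 (hTB h)
    have hdim := Submodule.finrank_sup_add_finrank_inf_eq (1 : Submodule K L) T
    rw [hdisj, finrank_bot, hone, hT] at hdim
    have hSne : S ≠ ⊥ := fun hb =>
      hli.ne_zero j ((Submodule.mem_bot K).1 (hb ▸ Submodule.subset_span ⟨j, hj, rfl⟩))
    have hCD := Submodule.finrank_add_finrank_le_of_mul_le A (hA.symm ▸ hn0) S (1 ⊔ T) hSne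
      (Submodule.mem_sup_left (Submodule.one_le.1 le_rfl)) (by
        rw [Submodule.mul_sup, mul_one]
        exact sup_le hSA hST)
    omega
  obtain ⟨b, hb⟩ := exists_basis_repr_eq_zero_of_finrank_inf_add_card_le
    (by simp [hB]) V hV
  refine ⟨fun i => b i, b.linearIndependent.map' B.subtype B.ker_subtype, ?_, ?_⟩
  · have : Set.range (fun i => (b i : L)) = B.subtype '' Set.range b := by
      rw [← Set.range_comp]
      rfl
    rw [this, Submodule.span_image, b.span_eq, Submodule.map_subtype_top]
  · intro i x hx hxB
    have hai : a i ≠ 0 := hli.ne_zero i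
    have hzero := hb i ⟨(a i)⁻¹ * x, hxB⟩ (by
      change a i * ((a i)⁻¹ * x) ∈ A
      rwa [mul_inv_cancel_left₀ hai])
    have hsum := congrArg (Subtype.val) (b.sum_repr ⟨(a i)⁻¹ * x, hxB⟩)
    rw [← show _ = (a i)⁻¹ * x from hsum, AddSubmonoidClass.coe_finsetSum]
    refine Submodule.sum_mem _ fun j _ => ?_
    rcases eq_or_ne j i with rfl | hj
    · rw [hzero]
      simp
    · exact Submodule.smul_mem _ _ (Submodule.subset_span ⟨j, hj, rfl⟩)
end

section
/- Let K ⊊ L be a field extension, and let A and B be n-dimensional K-subspaces of L with n > 0 and 1 ∉ B. Assume that for every a ∈ L and every intermediate field H with K ⊊ H ⊊ L and [H : K] finite, the inequality dim(aH ∩ A) + dim(H ∩ B) < [H : K] + 1 holds, where aH = {ah : h ∈ H} is regarded as a K-subspace of L. Then A is matched to B. -/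
open Module in
/-- Rado's theorem on independent transversals, for subspaces of a finite-dimensional space. -/
theorem exists_linearIndependent_mem_of_card_le_finrank_sup {K M ι : Type*} [Field K]
    [AddCommGroup M] [Module K M] [FiniteDimensional K M] [Fintype ι] [DecidableEq ι]
    (W : ι → Submodule K M) (hW : ∀ J : Finset ι, J.card ≤ finrank K ↥(J.sup W)) :
    ∃ w : ι → M, (∀ i, w i ∈ W i) ∧ LinearIndependent K w := by
  obtain ⟨U, hUW, hU⟩ := exists_minimal_le_of_wellFoundedLT
    (fun U : ι → Submodule K M => ∀ J : Finset ι, J.card ≤ finrank K ↥(J.sup U)) W hW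
  have hbad : ∀ i, ∀ P < U i, ∃ J : Finset ι, i ∉ J ∧ finrank K ↥(P ⊔ J.sup U) ≤ J.card := by
    intro i P hP
    have h1 : ¬ ∀ J : Finset ι, J.card ≤ finrank K ↥(J.sup (Function.update U i P)) :=
      hU.not_prop_of_lt (update_lt_self_iff.2 hP)
    push Not at h1
    obtain ⟨J, hJ⟩ := h1
    have hoff : ∀ J' : Finset ι, i ∉ J' → J'.sup (Function.update U i P) = J'.sup U := by
      intro J' hi
      refine Finset.sup_congr rfl fun j hj => Function.update_of_ne ?_ _ _
      rintro rfl
      exact hi hj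
    have hi : i ∈ J := by
      by_contra hi
      rw [hoff J hi] at hJ
      exact absurd (hU.prop J) (not_le.2 hJ)
    refine ⟨J.erase i, Finset.notMem_erase i J, ?_⟩
    rw [← Finset.insert_erase hi, Finset.sup_insert, hoff _ (Finset.notMem_erase i J),
      Function.update_self, Finset.card_insert_of_notMem (Finset.notMem_erase i J)] at hJ
    omega
  have hline : ∀ i, ∃ w ∈ U i, U i ≤ K ∙ w := by
    intro i
    by_cases h0 : U i = ⊥
    · exact ⟨0, zero_mem _, by simp [h0]⟩
    obtain ⟨w, hw, hw0⟩ := Submodule.exists_mem_ne_zero_of_ne_bot h0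
    refine ⟨w, hw, ?_⟩
    by_contra hle
    have hwU : K ∙ w ≤ U i := (Submodule.span_singleton_le_iff_mem _ _).2 hw
    obtain ⟨C, hC⟩ := Submodule.exists_isCompl (K ∙ w)
    have hsum : (K ∙ w) ⊔ C ⊓ U i = U i := by
      rw [← sup_inf_assoc_of_le C hwU, hC.sup_eq_top, top_inf_eq]
    have hlt : C ⊓ U i < U i := by
      refine inf_le_right.lt_of_ne fun h => hw0 ?_
      have hwC : w ∈ C := (inf_eq_right.1 h) hw
      exact (Submodule.mem_bot K).1
        (hC.inf_eq_bot ▸ ⟨Submodule.mem_span_singleton_self w, hwC⟩)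
    obtain ⟨J₁, hi₁, hJ₁⟩ := hbad i (K ∙ w) (lt_of_le_not_ge hwU hle)
    obtain ⟨J₂, hi₂, hJ₂⟩ := hbad i (C ⊓ U i) hlt
    have hmod := Submodule.finrank_sup_add_finrank_inf_eq
      ((K ∙ w) ⊔ J₁.sup U) ((C ⊓ U i) ⊔ J₂.sup U)
    have hsup : (insert i (J₁ ∪ J₂)).sup U ≤
        ((K ∙ w) ⊔ J₁.sup U) ⊔ ((C ⊓ U i) ⊔ J₂.sup U) := by
      rw [Finset.sup_insert, Finset.sup_union, sup_sup_sup_comm, hsum]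
    have hinf : (J₁ ∩ J₂).sup U ≤ ((K ∙ w) ⊔ J₁.sup U) ⊓ ((C ⊓ U i) ⊔ J₂.sup U) :=
      le_inf ((Finset.sup_mono Finset.inter_subset_left).trans le_sup_right)
        ((Finset.sup_mono Finset.inter_subset_right).trans le_sup_right)
    have h1 := (hU.prop _).trans (Submodule.finrank_mono hsup)
    have h2 := (hU.prop _).trans (Submodule.finrank_mono hinf)
    rw [Finset.card_insert_of_notMem (by simp [hi₁, hi₂])] at h1
    have h3 := Finset.card_union_add_card_inter J₁ J₂
    omega
  choose w hwU hspan using hline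
  refine ⟨w, fun i => hUW i (hwU i), ?_⟩
  rw [linearIndependent_iff_card_le_finrank_span]
  refine (hU.prop Finset.univ).trans (Submodule.finrank_mono (Finset.sup_le fun i _ => ?_))
  exact (hspan i).trans (Submodule.span_mono (by simp))

open Module in
/-- A family of subspaces whose intersections are small enough admits a basis each of whose
coordinate hyperplanes contains the corresponding subspace. -/
theorem exists_basis_le_span_image_ne {K M : Type*} [Field K] [AddCommGroup M] [Module K M]
    [FiniteDimensional K M] {n : ℕ} (hM : finrank K M = n) (V : Fin n → Submodule K M)
    (hV : ∀ J : Finset (Fin n), J.card + finrank K ↥(J.inf V) ≤ n) :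
    ∃ b : Basis (Fin n) K M, ∀ i, V i ≤ Submodule.span K (b '' {j | j ≠ i}) := by
  have hdual : ∀ J : Finset (Fin n),
      J.sup (fun i => (V i).dualAnnihilator) = (J.inf V).dualAnnihilator := by
    intro J
    induction J using Finset.induction_on with
    | empty => simp
    | insert i J _ ih => rw [Finset.sup_insert, Finset.inf_insert, ih,
        Subspace.dualAnnihilator_inf_eq]
  obtain ⟨φ, hφ, hli⟩ := exists_linearIndependent_mem_of_card_le_finrank_sup
    (fun i => (V i).dualAnnihilator) (fun J => by
      rw [hdual]
      have h1 := Subspace.finrank_add_finrank_dualAnnihilator_eq (J.inf V)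
      have h2 := hV J
      omega)
  have hcard : Fintype.card (Fin n) = finrank K (Dual K M) := by
    rw [Subspace.dual_finrank_eq, hM, Fintype.card_fin]
  let Φ : Basis (Fin n) K (Dual K M) := Basis.mk hli
    (hli.span_eq_top_of_card_eq_finrank' hcard).ge
  let b : Basis (Fin n) K M := Φ.dualBasis.map (evalEquiv K M).symm
  have hφb : ∀ i j, φ i (b j) = if i = j then 1 else 0 := by
    intro i j
    have h1 : φ i (b j) = evalEquiv K M (b j) (Φ i) := by simp [Φ]
    rw [h1, show evalEquiv K M (b j) = Φ.dualBasis j by simp [b], Basis.dualBasis_apply_self]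
  have hrepr : ∀ i v, φ i v = b.repr v i := by
    intro i v
    conv_lhs => rw [← b.sum_repr v, map_sum]
    simp only [map_smul, hφb, smul_eq_mul, mul_ite, mul_one, mul_zero, Finset.sum_ite_eq,
      Finset.mem_univ, if_true]
  refine ⟨b, fun i v hv => b.mem_span_image.2 fun j hj => ?_⟩
  rintro rfl
  rw [Finset.mem_coe, Finsupp.mem_support_iff, ← hrepr] at hj
  exact hj ((Submodule.mem_dualAnnihilator _).1 (hφ j) v hv)

open Module in
theorem finrank_map_mulLeft {K L : Type*} [Field K] [Field L] [Algebra K L] {a : L}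
    (ha : a ≠ 0) (T : Submodule K L) :
    finrank K ↥(T.map (LinearMap.mulLeft K a)) = finrank K T :=
  (Submodule.equivMapOfInjective _ (mul_right_injective₀ ha) T).finrank_eq.symm

open Module in
/-- Iterating the Dyson transform `(S, T) ↦ (S + eT, T ∩ e⁻¹S)` leads to a pair `(S, T)`
with `ST ⊆ S`. -/
theorem exists_mul_le_self_of_mul_le {K L : Type*} [Field K] [Field L] [Algebra K L]
    {A : Submodule K L} [FiniteDimensional K A] (S T : Submodule K L) [FiniteDimensional K T]
    (hS : S ≠ ⊥) (hT : 1 ∈ T) (hST : S * T ≤ A) :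
    ∃ S' T' : Submodule K L, S' ≠ ⊥ ∧ S' ≤ A ∧ T' ≤ T ∧ 1 ∈ T' ∧ S' * T' ≤ S' ∧
      finrank K S' + finrank K T' = finrank K S + finrank K T := by
  induction hk : finrank K T using Nat.strong_induction_on generalizing S T with
  | _ k ih =>
  have hSA : S ≤ A := fun s hs => hST (by simpa using Submodule.mul_mem_mul hs hT)
  by_cases hstab : S * T ≤ S
  · exact ⟨S, T, hS, hSA, le_rfl, hT, hstab, by rw [hk]⟩
  rw [Submodule.mul_le] at hstab
  push Not at hstab
  obtain ⟨e, he, t, ht, het⟩ := hstab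
  have he0 : e ≠ 0 := by
    rintro rfl
    simp at het
  set m := LinearMap.mulLeft K e with hm
  have hlt : T ⊓ S.comap m < T :=
    inf_le_left.lt_of_ne fun h => het (inf_eq_left.1 h ht)
  have hmap : (T ⊓ S.comap m).map m = S ⊓ T.map m := by
    ext x
    simp only [Submodule.mem_map, Submodule.mem_inf, Submodule.mem_comap]
    constructor
    · rintro ⟨y, ⟨hy, hy'⟩, rfl⟩
      exact ⟨hy', y, hy, rfl⟩
    · rintro ⟨hx, y, hy, rfl⟩
      exact ⟨y, ⟨hy, hx⟩, rfl⟩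
  have : FiniteDimensional K S := Submodule.finiteDimensional_of_le hSA
  have : FiniteDimensional K ↥(T ⊓ S.comap m) := Submodule.finiteDimensional_of_le hlt.le
  have hdim := Submodule.finrank_sup_add_finrank_inf_eq S (T.map m)
  rw [← hmap, finrank_map_mulLeft he0, finrank_map_mulLeft he0] at hdim
  have hmul : (S ⊔ T.map m) * (T ⊓ S.comap m) ≤ A := by
    rw [Submodule.sup_mul]
    refine sup_le ((mul_le_mul_right inf_le_left S).trans hST) (Submodule.mul_le.2 ?_)
    rintro _ ⟨y, hy, rfl⟩ z ⟨-, hz⟩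
    have := hST (Submodule.mul_mem_mul hz hy)
    simpa [hm, mul_comm, mul_left_comm] using this
  obtain ⟨S', T', h1, h2, h3, h4, h5, h6⟩ := ih _ (hk ▸ Submodule.finrank_lt_finrank_of_lt hlt)
    (S ⊔ T.map m) (T ⊓ S.comap m) (ne_bot_of_le_ne_bot hS le_sup_left)
    ⟨hT, by simpa [hm] using he⟩ hmul rfl
  exact ⟨S', T', h1, h2, h3.trans inf_le_left, h4, h5, by omega⟩

open Module in
/-- The set of multipliers of a nonzero finite-dimensional subspace is an intermediate field. -/
theorem exists_intermediateField_mem_iff_mul_mem {K L : Type*} [Field K] [Field L] [Algebra K L]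
    (S : Submodule K L) [FiniteDimensional K S] (hS : S ≠ ⊥) :
    ∃ H : IntermediateField K L, FiniteDimensional K H ∧
      ∀ x, x ∈ H ↔ ∀ s ∈ S, x * s ∈ S := by
  obtain ⟨a, ha, ha0⟩ := Submodule.exists_mem_ne_zero_of_ne_bot hS
  let R : Subalgebra K L :=
    { carrier := {x | ∀ s ∈ S, x * s ∈ S}
      mul_mem' := fun {x y} hx hy s hs => by
        rw [mul_assoc]
        exact hx _ (hy _ hs)
      add_mem' := fun {x y} hx hy s hs => by
        rw [add_mul]
        exact add_mem (hx _ hs) (hy _ hs)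
      algebraMap_mem' := fun r s hs => by
        rw [← Algebra.smul_def]
        exact S.smul_mem r hs }
  have hfin : FiniteDimensional K R :=
    Module.Finite.of_injective
      (((LinearMap.mulLeft K a).comp R.val.toLinearMap).codRestrict S
        fun x => by simpa [mul_comm] using x.2 a ha)
      fun x y hxy => Subtype.ext (mul_left_cancel₀ ha0 (congrArg Subtype.val hxy))
  have hinv : ∀ x ∈ R, x⁻¹ ∈ R := fun x hx =>
    R.inv_mem_of_algebraic (x := ⟨x, hx⟩)
      ((Algebra.IsAlgebraic.isAlgebraic (R := K) (⟨x, hx⟩ : R)).algebraMap (A := L))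
  exact ⟨R.toIntermediateField hinv, hfin, fun x => Iff.rfl⟩

open Module in
/-- Under the dimension criterion on intermediate fields, `SV ⊆ A` forces
`dim S + dim V ≤ dim A` for nonzero `S ⊆ A` and every `V ⊆ B`. -/
theorem finrank_add_finrank_le_of_mul_le {K L : Type*} [Field K] [Field L] [Algebra K L]
    {A B : Submodule K L} [FiniteDimensional K A] [FiniteDimensional K B]
    (hAB : finrank K A = finrank K B) (h1 : (1 : L) ∉ B)
    (hineq : ∀ (a : L) (H : IntermediateField K L), H ≠ ⊥ → H ≠ ⊤ →
      FiniteDimensional K H →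
      finrank K ↥((Submodule.map (LinearMap.mulLeft K a)
          (Subalgebra.toSubmodule H.toSubalgebra)) ⊓ A) +
        finrank K ↥((Subalgebra.toSubmodule H.toSubalgebra) ⊓ B) < finrank K ↥H + 1)
    {S V : Submodule K L} (hS : S ≠ ⊥) (hSA : S ≤ A) (hVB : V ≤ B) (hSV : S * V ≤ A) :
    finrank K S + finrank K V ≤ finrank K A := by
  by_contra! hlt
  have : FiniteDimensional K V := Submodule.finiteDimensional_of_le hVB
  have hdisj : ∀ U ≤ B, (K ∙ (1 : L)) ⊓ U = ⊥ := by
    intro U hU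
    rw [← disjoint_iff, disjoint_comm, Submodule.disjoint_span_singleton' one_ne_zero]
    exact fun h => h1 (hU h)
  have hdim : ∀ U ≤ B, finrank K ↥((K ∙ (1 : L)) ⊔ U) = 1 + finrank K U := by
    intro U hU
    have : FiniteDimensional K U := Submodule.finiteDimensional_of_le hU
    have h := Submodule.finrank_sup_add_finrank_inf_eq (K ∙ (1 : L)) U
    rwa [hdisj U hU, finrank_bot, add_zero, finrank_span_singleton one_ne_zero] at h
  have hS1 : S * (K ∙ (1 : L)) = S := by
    rw [← Submodule.one_eq_span, mul_one]
  obtain ⟨S', T, hS', hS'A, hTV, hT1, hstab, hsum⟩ :=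
    exists_mul_le_self_of_mul_le (A := A) S ((K ∙ (1 : L)) ⊔ V) hS
      (Submodule.mem_sup_left (Submodule.mem_span_singleton_self 1))
      (by rw [Submodule.mul_sup, hS1]; exact sup_le hSA hSV)
  rw [hdim V hVB] at hsum
  have : FiniteDimensional K S' := Submodule.finiteDimensional_of_le hS'A
  have : FiniteDimensional K T := Submodule.finiteDimensional_of_le hTV
  obtain ⟨H, hHfin, hH⟩ := exists_intermediateField_mem_iff_mul_mem S' hS'
  obtain ⟨a, ha, ha0⟩ := Submodule.exists_mem_ne_zero_of_ne_bot hS'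
  have hTH : T ≤ Subalgebra.toSubmodule H.toSubalgebra := fun t ht =>
    (hH t).2 fun s hs => by
      rw [mul_comm]
      exact hstab (Submodule.mul_mem_mul hs ht)
  have haH : (Subalgebra.toSubmodule H.toSubalgebra).map (LinearMap.mulLeft K a) ≤ A := by
    rintro _ ⟨x, hx, rfl⟩
    have := (hH x).1 hx a ha
    rw [LinearMap.mulLeft_apply, mul_comm]
    exact hS'A this
  have hS'dim := Submodule.finrank_mono hS'A
  have hTB : 2 ≤ finrank K ↥T ∧ finrank K T ≤ 1 + finrank K ↥(T ⊓ B) := by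
    refine ⟨by omega, ?_⟩
    have hle : T ⊔ B ≤ (K ∙ (1 : L)) ⊔ B :=
      sup_le (hTV.trans (sup_le_sup_left hVB _)) le_sup_right
    have h2 := Submodule.finrank_mono hle
    rw [hdim B le_rfl] at h2
    have h3 := Submodule.finrank_sup_add_finrank_inf_eq T B
    omega
  have hfinH : FiniteDimensional K (Subalgebra.toSubmodule H.toSubalgebra) := hHfin
  have hHdim : finrank K ↥(Subalgebra.toSubmodule H.toSubalgebra) = finrank K H := rfl
  have hTHdim := Submodule.finrank_mono hTH
  have hbot : H ≠ ⊥ := by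
    rintro rfl
    rw [hHdim, IntermediateField.finrank_bot] at hTHdim
    omega
  have htop : H ≠ ⊤ := by
    rintro rfl
    have hA : A = ⊤ := by
      refine eq_top_iff.2 fun x _ => haH
        ⟨a⁻¹ * x, (IntermediateField.mem_top : a⁻¹ * x ∈ (⊤ : IntermediateField K L)), ?_⟩
      simp [ha0]
    subst hA
    have : FiniteDimensional K L := Module.Finite.equiv (Submodule.topEquiv (R := K) (M := L))
    have hB : B = ⊤ := Submodule.eq_top_of_finrank_eq (by rw [← hAB, finrank_top])
    exact h1 (hB ▸ Submodule.mem_top)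
  have hmain := hineq a H hbot htop hHfin
  rw [inf_eq_left.2 haH, finrank_map_mulLeft ha0, hHdim] at hmain
  have h4 := Submodule.finrank_mono (inf_le_inf_right B hTH)
  omega


/-- If for every `a ∈ L` and every nontrivial proper finite-dimensional intermediate
field `H` of `K ⊊ L` one has `dim (aH ∩ A) + dim (H ∩ B) < [H : K] + 1`, then `A`
is matched to `B`.  Here `aH` is the `K`-subspace which is the image of `H` under
multiplication by `a`. -/
theorem stmt_17 {K L : Type*} [Field K] [Field L] [Algebra K L]
    (hKL : ∃ x : L, x ∉ Set.range (algebraMap K L))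
    (A B : Submodule K L) (n : ℕ) (hn : 0 < n)
    (hA : Module.finrank K A = n) (hB : Module.finrank K B = n)
    (h1 : (1 : L) ∉ B)
    (hineq : ∀ (a : L) (H : IntermediateField K L), H ≠ ⊥ → H ≠ ⊤ →
      FiniteDimensional K H →
      Module.finrank K ↥((Submodule.map (LinearMap.mulLeft K a)
          (Subalgebra.toSubmodule H.toSubalgebra)) ⊓ A) +
        Module.finrank K ↥((Subalgebra.toSubmodule H.toSubalgebra) ⊓ B) <
        Module.finrank K ↥H + 1) :
    IsMatchedTo A B := by
  have hAfin : FiniteDimensional K A := Module.finite_of_finrank_pos (hA ▸ hn)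
  have hBfin : FiniteDimensional K B := Module.finite_of_finrank_pos (hB ▸ hn)
  intro m a ha hspan
  have hm : Module.finrank K A = m := by
    rw [← hspan, finrank_span_eq_card ha, Fintype.card_fin]
  have haA : ∀ i, a i ∈ A := fun i => hspan ▸ Submodule.subset_span ⟨i, rfl⟩
  let V : Fin m → Submodule K B := fun i =>
    (A.comap (LinearMap.mulLeft K (a i))).comap B.subtype
  obtain ⟨b, hb⟩ := exists_basis_le_span_image_ne (hB.trans (hA.symm.trans hm)) V fun J => by
    rcases J.eq_empty_or_nonempty with rfl | ⟨i₀, hi₀⟩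
    · rw [Finset.card_empty, zero_add, Finset.inf_empty, finrank_top]
      exact (hB.trans (hA.symm.trans hm)).le
    have hcard : Module.finrank K ↥(Submodule.span K (a '' J)) = J.card := by
      rw [Set.image_eq_range]
      exact (finrank_span_eq_card (ha.comp _ Subtype.val_injective)).trans (by simp)
    have hV : Module.finrank K ↥((J.inf V).map B.subtype) = Module.finrank K ↥(J.inf V) :=
      (Submodule.equivMapOfInjective _ B.injective_subtype _).finrank_eq.symm
    rw [← hcard, ← hV]
    refine (finrank_add_finrank_le_of_mul_le (hA.trans hB.symm) h1 hineq ?_ ?_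
      (Submodule.map_subtype_le _ _) ?_).trans hm.le
    · exact Submodule.ne_bot_iff _ |>.2
        ⟨a i₀, Submodule.subset_span ⟨i₀, hi₀, rfl⟩, ha.ne_zero i₀⟩
    · rw [Submodule.span_le]
      rintro _ ⟨i, -, rfl⟩
      exact haA i
    · rw [← Submodule.span_eq ((J.inf V).map B.subtype), Submodule.span_mul_span,
        Submodule.span_le]
      rintro _ ⟨_, ⟨i, hi, rfl⟩, _, ⟨v, hv, rfl⟩, rfl⟩
      exact (Finset.inf_le hi : J.inf V ≤ V i) hv
  refine ⟨fun i => b i, b.linearIndependent.map' B.subtype B.ker_subtype, ?_, ?_⟩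
  · have h := congrArg (Submodule.map B.subtype) b.span_eq
    rwa [Submodule.map_span, ← Set.range_comp, Submodule.map_subtype_top] at h
  · intro i x hx hxB
    have hxV : (⟨(a i)⁻¹ * x, hxB⟩ : B) ∈ V i := by
      simpa [V, mul_inv_cancel_left₀ (ha.ne_zero i)] using hx
    have h := Submodule.mem_map_of_mem (f := B.subtype) (hb i hxV)
    rwa [Submodule.map_span, ← Set.image_comp] at h
end
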